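/- arXiv:2602.15986 — 7 statements merged into one kernel-verified Lean document; each statement's English description precedes it below -/
import Mathlib

section
/- Let G ∈ {0,1}^{N×N} be a symmetric adjacency matrix with zero diagonal and let δ ∈ [0,1] satisfy δ·|λ_min(G)| < 1, where λ_min(G) is the smallest eigenvalue of G. Then the best-response map F_i(x) = max(0, 1 − δ Σ_j g_{ij} x_j) has at most one fixed point in [0,1]^N; i.e., the Nash equilibrium of the network game is unique. -/
open Matrix Finset

/-- The smallest eigenvalue of a real symmetric matrix, via its Rayleigh
quotient characterization `λ_min(A) = min_{x ≠ 0} (xᵀAx)/(xᵀx)`. -/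
noncomputable def lambdaMin {ι : Type*} [Fintype ι] (A : Matrix ι ι ℝ) : ℝ :=
  ⨅ x : {x : ι → ℝ // x ≠ 0}, (x.1 ⬝ᵥ A.mulVec x.1) / (x.1 ⬝ᵥ x.1)

/-- The quadratic form of a real matrix is bounded below by a multiple of the squared norm. -/
theorem neg_sum_abs_mul_le_dotProduct_mulVec {ι : Type*} [Fintype ι] (A : Matrix ι ι ℝ)
    (v : ι → ℝ) : -(∑ i, ∑ j, |A i j|) * (v ⬝ᵥ v) ≤ v ⬝ᵥ A.mulVec v := by
  have hsq : ∀ i, v i ^ 2 ≤ v ⬝ᵥ v := fun i => by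
    rw [sq]
    exact Finset.single_le_sum (f := fun i => v i * v i) (fun j _ => mul_self_nonneg (v j))
      (Finset.mem_univ i)
  simp only [← Finset.sum_neg_distrib, Finset.sum_mul]
  rw [dotProduct.eq_1 v (A.mulVec v)]
  refine Finset.sum_le_sum fun i _ => ?_
  rw [mulVec, dotProduct.eq_1 (A i) v, Finset.mul_sum]
  refine Finset.sum_le_sum fun j _ => ?_
  have hprod : |v i * v j| ≤ v ⬝ᵥ v := abs_le.2
    ⟨by nlinarith [hsq i, hsq j, sq_nonneg (v i + v j)],
      by nlinarith [hsq i, hsq j, sq_nonneg (v i - v j)]⟩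
  have habs := neg_abs_le (A i j * (v i * v j))
  rw [abs_mul] at habs
  nlinarith [mul_le_mul_of_nonneg_left hprod (abs_nonneg (A i j))]

/-- The Rayleigh bound `λ_min(A) ‖v‖² ≤ vᵀAv`. -/
theorem lambdaMin_mul_dotProduct_le {ι : Type*} [Fintype ι] (A : Matrix ι ι ℝ) (v : ι → ℝ) :
    lambdaMin A * (v ⬝ᵥ v) ≤ v ⬝ᵥ A.mulVec v := by
  by_cases hv : v = 0
  · simp [hv]
  have hpos : ∀ w : ι → ℝ, w ≠ 0 → 0 < w ⬝ᵥ w := fun w hw =>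
    lt_of_le_of_ne (Finset.sum_nonneg fun i _ => mul_self_nonneg (w i))
      fun h => hw (dotProduct_self_eq_zero.1 h.symm)
  have hbdd : BddBelow (Set.range fun w : {w : ι → ℝ // w ≠ 0} =>
      (w.1 ⬝ᵥ A.mulVec w.1) / (w.1 ⬝ᵥ w.1)) := by
    refine ⟨-(∑ i, ∑ j, |A i j|), ?_⟩
    rintro _ ⟨w, rfl⟩
    exact (le_div_iff₀ (hpos w.1 w.2)).2 (neg_sum_abs_mul_le_dotProduct_mulVec A w.1)
  exact (le_div_iff₀ (hpos v hv)).1 (ciInf_le hbdd ⟨v, hv⟩)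

/-- The positive part is firmly nonexpansive. -/
theorem sq_max_zero_sub_le (a b : ℝ) :
    (max 0 a - max 0 b) * (max 0 a - max 0 b) ≤ (max 0 a - max 0 b) * (a - b) := by
  rcases le_total 0 a with ha | ha <;> rcases le_total 0 b with hb | hb <;>
    simp only [max_eq_left, max_eq_right, ha, hb] <;> nlinarith

/-- if `δ · |λ_min(G)| < 1` then the best-response map has at
most one fixed point in `[0,1]^N`, i.e. the Nash equilibrium is unique. -/
theorem equilibrium_unique
    (n : ℕ) (hn : 0 < n) (G : Matrix (Fin n) (Fin n) ℝ)
    (hsymm : G.IsSymm)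
    (h01 : ∀ i j, G i j = 0 ∨ G i j = 1)
    (hdiag : ∀ i, G i i = 0)
    (δ : ℝ) (hδ : δ ∈ Set.Icc (0 : ℝ) 1)
    (hlam : δ * |lambdaMin G| < 1) :
    ∀ x y : Fin n → ℝ,
      (∀ i, x i ∈ Set.Icc (0 : ℝ) 1) → (∀ i, y i ∈ Set.Icc (0 : ℝ) 1) →
      (∀ i, x i = max 0 (1 - δ * ∑ j, G i j * x j)) →
      (∀ i, y i = max 0 (1 - δ * ∑ j, G i j * y j)) →
      x = y := by
  intro x y _ _ hx hy
  have hle : (x - y) ⬝ᵥ (x - y) ≤ -δ * ((x - y) ⬝ᵥ G.mulVec (x - y)) := by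
    rw [dotProduct, dotProduct, Finset.mul_sum]
    refine Finset.sum_le_sum fun i _ => ?_
    have h := sq_max_zero_sub_le (1 - δ * ∑ j, G i j * x j) (1 - δ * ∑ j, G i j * y j)
    rw [← hx i, ← hy i] at h
    have hG : G.mulVec (x - y) i = ∑ j, G i j * x j - ∑ j, G i j * y j := by
      rw [mulVec_sub]
      rfl
    rw [hG, Pi.sub_apply]
    linarith
  have hnonneg : 0 ≤ (x - y) ⬝ᵥ (x - y) :=
    Finset.sum_nonneg fun i _ => mul_self_nonneg ((x - y) i)
  have hray := mul_le_mul_of_nonneg_left (lambdaMin_mul_dotProduct_le G (x - y)) hδ.1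
  have habs := mul_le_mul_of_nonneg_left
    (mul_le_mul_of_nonneg_right (neg_abs_le (lambdaMin G)) hnonneg) hδ.1
  have hzero : (x - y) ⬝ᵥ (x - y) = 0 := by nlinarith
  exact sub_eq_zero.1 (dotProduct_self_eq_zero.1 hzero)
end

section
/- Let B be a real symmetric n×n matrix with all diagonal entries equal to 1, let f(0) ∈ ℝⁿ, let (i_t)_{t≥1} be any sequence of indices in {1,…,n}, and define recursively f(t+1) = f(t) − e_{i_{t+1}} (B f(t))_{i_{t+1}}. If B is positive semidefinite, then for every T ≥ 0 one has Σ_{t=0}^{T−1} ((B f(t))_{i_{t+1}})² ≤ f(0)ᵀ B f(0). -/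
open Matrix Finset

/-- A coordinate update by `(B v)ᵢ` lowers the quadratic form of a symmetric matrix with `B i i = 1`
by exactly `(B v)ᵢ ^ 2`. -/
theorem dotProduct_mulVec_sub_single {ι R : Type*} [Fintype ι] [DecidableEq ι] [CommRing R]
    {B : Matrix ι ι R} (hB : B.IsSymm) {i : ι} (hi : B i i = 1) (v : ι → R) :
    (v - Pi.single i (B.mulVec v i)) ⬝ᵥ B.mulVec (v - Pi.single i (B.mulVec v i))
      = v ⬝ᵥ B.mulVec v - B.mulVec v i ^ 2 := by
  have hcomm : ∀ c : R, v ⬝ᵥ B.mulVec (Pi.single i c) = c * B.mulVec v i := fun c => by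
    rw [dotProduct_mulVec, ← mulVec_transpose, hB.eq, dotProduct_single, mul_comm]
  rw [mulVec_sub, sub_dotProduct, dotProduct_sub, dotProduct_sub, hcomm, single_dotProduct,
    single_dotProduct, mulVec_single, Pi.smul_apply, col_apply, hi, op_smul_eq_mul]
  ring

/-- along the best-response dynamics
`f(t+1) = f(t) − e_{i_{t+1}} (B f(t))_{i_{t+1}}` with `B` positive semidefinite
(symmetric, unit diagonal), the partial sums of the squared increments are
bounded by the initial quadratic form `f(0)ᵀ B f(0)`. -/
theorem sum_of_squared_updates_le
    (n : ℕ) (B : Matrix (Fin n) (Fin n) ℝ)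
    (hdiag : ∀ i, B i i = 1) (hB : B.PosSemidef)
    (f : ℕ → Fin n → ℝ) (idx : ℕ → Fin n)
    (hrec : ∀ t, f (t + 1)
      = f t - Pi.single (idx (t + 1)) (B.mulVec (f t) (idx (t + 1)))) :
    ∀ T : ℕ, ∑ t ∈ Finset.range T, (B.mulVec (f t) (idx (t + 1))) ^ 2
      ≤ f 0 ⬝ᵥ B.mulVec (f 0) := by
  intro T
  have hsymm : B.IsSymm := by
    simpa [IsHermitian, IsSymm, conjTranspose_eq_transpose_of_trivial] using hB.isHermitian
  have hstep : ∀ t, (B.mulVec (f t) (idx (t + 1))) ^ 2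
      = f t ⬝ᵥ B.mulVec (f t) - f (t + 1) ⬝ᵥ B.mulVec (f (t + 1)) := fun t => by
    rw [hrec t, dotProduct_mulVec_sub_single hsymm (hdiag _), sub_sub_cancel]
  have hnonneg : 0 ≤ f T ⬝ᵥ B.mulVec (f T) := by
    simpa using hB.dotProduct_mulVec_nonneg (f T)
  simp only [hstep]
  rw [Finset.sum_range_sub' (fun t => f t ⬝ᵥ B.mulVec (f t))]
  linarith
end

section
/- Let B be a real symmetric positive definite n×n matrix with all diagonal entries equal to 1, and let λ_min(B) be its smallest eigenvalue. Then for every f ∈ ℝⁿ, (1/n) Σ_{i=1}^{n} (f − e_i(Bf)_i)ᵀ B (f − e_i(Bf)_i) ≤ (1 − λ_min(B)/n) · fᵀBf. In words: one uniformly random best-response update decreases the expected B-weighted squared error by at least the factor 1 − λ_min(B)/n. -/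
open Matrix Finset

theorem Matrix.PosSemidef.rayleigh_nonneg {ι : Type*} [Fintype ι] {A : Matrix ι ι ℝ}
    (hA : A.PosSemidef) (x : ι → ℝ) : 0 ≤ (x ⬝ᵥ A.mulVec x) / (x ⬝ᵥ x) :=
  div_nonneg (by simpa using hA.dotProduct_mulVec_nonneg x)
    (by simpa using dotProduct_star_self_nonneg x)

theorem lambdaMin_nonneg {ι : Type*} [Fintype ι] {A : Matrix ι ι ℝ}
    (hA : A.PosSemidef) : 0 ≤ lambdaMin A :=
  Real.iInf_nonneg fun x => hA.rayleigh_nonneg x.1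

theorem lambdaMin_mul_dotProduct_self_le {ι : Type*} [Fintype ι] {A : Matrix ι ι ℝ}
    (hA : A.PosSemidef) (x : ι → ℝ) : lambdaMin A * (x ⬝ᵥ x) ≤ x ⬝ᵥ A.mulVec x := by
  rcases eq_or_ne x 0 with rfl | hx
  · simp
  have hpos : 0 < x ⬝ᵥ x := by simpa using dotProduct_star_self_pos_iff.2 hx
  rw [← le_div_iff₀ hpos]
  exact ciInf_le (f := fun x : {x : ι → ℝ // x ≠ 0} => (x.1 ⬝ᵥ A.mulVec x.1) / (x.1 ⬝ᵥ x.1))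
    ⟨0, by rintro _ ⟨y, rfl⟩; exact hA.rayleigh_nonneg y.1⟩ ⟨x, hx⟩

theorem lambdaMin_mul_quadForm_le {ι : Type*} [Fintype ι] {A : Matrix ι ι ℝ}
    (hA : A.PosSemidef) (x : ι → ℝ) :
    lambdaMin A * (x ⬝ᵥ A.mulVec x) ≤ A.mulVec x ⬝ᵥ A.mulVec x := by
  have hq : 0 ≤ x ⬝ᵥ A.mulVec x := by simpa using hA.dotProduct_mulVec_nonneg x
  have hg : 0 ≤ A.mulVec x ⬝ᵥ A.mulVec x := by
    simpa using dotProduct_star_self_nonneg (A.mulVec x)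
  have hcs : (x ⬝ᵥ A.mulVec x) ^ 2 ≤ (x ⬝ᵥ x) * (A.mulVec x ⬝ᵥ A.mulVec x) := by
    simpa only [dotProduct, sq] using sum_mul_sq_le_sq_mul_sq univ x (A.mulVec x)
  rcases hq.eq_or_lt with h0 | hpos
  · simpa [← h0] using hg
  refine le_of_mul_le_mul_right ?_ hpos
  calc lambdaMin A * (x ⬝ᵥ A.mulVec x) * (x ⬝ᵥ A.mulVec x)
      = lambdaMin A * (x ⬝ᵥ A.mulVec x) ^ 2 := by ring
    _ ≤ lambdaMin A * ((x ⬝ᵥ x) * (A.mulVec x ⬝ᵥ A.mulVec x)) :=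
        mul_le_mul_of_nonneg_left hcs (lambdaMin_nonneg hA)
    _ = lambdaMin A * (x ⬝ᵥ x) * (A.mulVec x ⬝ᵥ A.mulVec x) := by ring
    _ ≤ (x ⬝ᵥ A.mulVec x) * (A.mulVec x ⬝ᵥ A.mulVec x) :=
        mul_le_mul_of_nonneg_right (lambdaMin_mul_dotProduct_self_le hA x) hg
    _ = _ := mul_comm _ _

/-- A coordinate update along `i` lowers the quadratic form by the squared `i`-th residual. -/
theorem quadForm_sub_single {ι : Type*} [Fintype ι] [DecidableEq ι] {A : Matrix ι ι ℝ}
    (hA : A.IsSymm) {i : ι} (hi : A i i = 1) (x : ι → ℝ) :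
    (x - Pi.single i (A.mulVec x i)) ⬝ᵥ A.mulVec (x - Pi.single i (A.mulVec x i)) =
      x ⬝ᵥ A.mulVec x - A.mulVec x i * A.mulVec x i := by
  have hsymm (c : ℝ) : x ⬝ᵥ A.mulVec (Pi.single i c) = A.mulVec x i * c := by
    rw [dotProduct_mulVec, ← mulVec_transpose, hA.eq, dotProduct_single]
  rw [mulVec_sub, sub_dotProduct, dotProduct_sub, dotProduct_sub, hsymm, single_dotProduct,
    single_dotProduct, mulVec_single]
  simp [hi]

/-- one uniformly random best-response update decreases the
expected `B`-weighted squared error by at least the factor `1 − λ_min(B)/n`. -/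
theorem expected_error_decrease
    (n : ℕ) (hn : 0 < n) (B : Matrix (Fin n) (Fin n) ℝ)
    (hB : B.PosDef) (hdiag : ∀ i, B i i = 1) (f : Fin n → ℝ) :
    (1 / (n : ℝ)) * ∑ i, ((f - Pi.single i (B.mulVec f i)) ⬝ᵥ
        B.mulVec (f - Pi.single i (B.mulVec f i)))
      ≤ (1 - lambdaMin B / n) * (f ⬝ᵥ B.mulVec f) := by
  have hn' : (0 : ℝ) < n := Nat.cast_pos.2 hn
  have hsymm : B.IsSymm := by simpa using hB.isHermitian
  have hsum : ∑ i, ((f - Pi.single i (B.mulVec f i)) ⬝ᵥ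
      B.mulVec (f - Pi.single i (B.mulVec f i))) =
      n * (f ⬝ᵥ B.mulVec f) - B.mulVec f ⬝ᵥ B.mulVec f := by
    simp_rw [quadForm_sub_single hsymm (hdiag _), sum_sub_distrib]
    simp [dotProduct]
  rw [hsum, one_div, inv_mul_le_iff₀ hn']
  calc n * (f ⬝ᵥ B.mulVec f) - B.mulVec f ⬝ᵥ B.mulVec f
      ≤ n * (f ⬝ᵥ B.mulVec f) - lambdaMin B * (f ⬝ᵥ B.mulVec f) :=
        sub_le_sub_left (lambdaMin_mul_quadForm_le hB.posSemidef f) _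
    _ = n * ((1 - lambdaMin B / n) * (f ⬝ᵥ B.mulVec f)) := by field_simp
end

section
/- Let G(n) be the adjacency matrix of the path graph on n = 2m vertices (m ≥ 1) and let δ satisfy 1/2 < δ < −1/(2cos(2mπ/(2m+1))). Then the matrix I + δG(n) is invertible and every entry of the vector x = (I + δG(n))⁻¹ 𝟙 is strictly positive; explicitly, writing δ = −1/(2cosθ) with θ ∈ ((2m/(2m+1))π, π], one has x_i = −2 sin(iθ/2) sin((2m+1−i)θ/2) / ((1+2δ) cos((2m+1)θ/2)) > 0 for all i ∈ {1,…,2m}. Consequently the unique equilibrium of the network game on this path has all 2m agents active. -/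
open Matrix Finset Real

/-- Adjacency matrix of the path graph on `n` vertices:
`g i j = 1` iff `|i − j| = 1`. -/
def pathAdj (n : ℕ) : Matrix (Fin n) (Fin n) ℝ :=
  Matrix.of fun i j => if (i : ℕ) + 1 = (j : ℕ) ∨ (j : ℕ) + 1 = (i : ℕ) then 1 else 0

/-- The neighbour sum on the path, for a function on `{0, …, n + 1}` vanishing at both ends. -/
theorem sum_pathAdj_mul {n : ℕ} (f : ℕ → ℝ) (h0 : f 0 = 0) (hn : f (n + 1) = 0) (i : Fin n) :
    ∑ j : Fin n, pathAdj n i j * f (j + 1) = f i + f (i + 2) := by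
  have hterm : ∀ j : Fin n, pathAdj n i j * f (j + 1) =
      (if (j : ℕ) = i + 1 then f (j + 1) else 0) + (if (j : ℕ) + 1 = i then f (j + 1) else 0) := by
    intro j
    simp only [pathAdj, Matrix.of_apply]
    split_ifs <;> first | omega | simp
  have hright : ∑ j : Fin n, (if (j : ℕ) = i + 1 then f (j + 1) else 0) = f (i + 2) := by
    rw [Fin.sum_univ_eq_sum_range (fun j => if j = (i : ℕ) + 1 then f (j + 1) else 0) n,
      Finset.sum_ite_eq']
    split_ifs with h
    · rfl
    · have : (i : ℕ) + 2 = n + 1 := by have := i.2; simp at h; omega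
      rw [this, hn]
  have hleft : ∑ j : Fin n, (if (j : ℕ) + 1 = i then f (j + 1) else 0) = f i := by
    rw [Fin.sum_univ_eq_sum_range (fun j => if j + 1 = (i : ℕ) then f (j + 1) else 0) n]
    obtain ⟨_ | k, hk⟩ := i
    · simp [h0]
    · have hk' : k < n := by omega
      simp [hk']
  rw [Finset.sum_congr rfl fun j _ => hterm j, Finset.sum_add_distrib, hright, hleft, add_comm]

theorem one_add_smul_pathAdj_mulVec {n : ℕ} (δ : ℝ) (v : Fin n → ℝ) (i : Fin n) :
    ((1 + δ • pathAdj n).mulVec v) i = v i + δ * ∑ j, pathAdj n i j * v j := by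
  rw [Matrix.add_mulVec, Matrix.one_mulVec, Matrix.smul_mulVec]
  rfl

/-- A solution of the Chebyshev recurrence with `w 0 = 0` is a multiple of `sin (k θ)`. -/
theorem mul_sin_eq_of_recurrence {n : ℕ} {θ : ℝ} (w : ℕ → ℝ) (h0 : w 0 = 0)
    (hrec : ∀ k < n, w k + w (k + 2) = 2 * Real.cos θ * w (k + 1)) :
    ∀ k ≤ n + 1, w k * Real.sin θ = w 1 * Real.sin (k * θ) := by
  intro k
  induction k using Nat.twoStepInduction with
  | zero => simp [h0]
  | one => simp
  | more k ih1 ih2 =>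
    intro hk
    have e1 := ih1 (by omega)
    have e2 := ih2 (by omega)
    have hr := hrec k (by omega)
    have ht : Real.sin ((k + 2 : ℕ) * θ) =
        2 * Real.cos θ * Real.sin ((k + 1 : ℕ) * θ) - Real.sin (k * θ) := by
      have a1 : ((k + 2 : ℕ) : ℝ) * θ = (k + 1 : ℕ) * θ + θ := by push_cast; ring
      have a2 : (k : ℝ) * θ = (k + 1 : ℕ) * θ - θ := by push_cast; ring
      rw [a1, a2, Real.sin_add, Real.sin_sub]
      ring
    rw [ht]
    linear_combination Real.sin θ * hr + 2 * Real.cos θ * e2 - e1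

theorem isUnit_det_one_add_smul_pathAdj {n : ℕ} {δ θ : ℝ} (hδ : 2 * δ * Real.cos θ = -1)
    (hsin : Real.sin θ ≠ 0) (hsin' : Real.sin ((n + 1 : ℕ) * θ) ≠ 0) :
    IsUnit (1 + δ • pathAdj n).det := by
  rw [isUnit_iff_ne_zero]
  intro hdet
  obtain ⟨v, hv, hv0⟩ := Matrix.exists_mulVec_eq_zero_iff.mpr hdet
  apply hv
  let w : ℕ → ℝ := fun k => if h : 1 ≤ k ∧ k ≤ n then v ⟨k - 1, by omega⟩ else 0
  have w0 : w 0 = 0 := by simp [w]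
  have wn : w (n + 1) = 0 := by simp [w]
  have wv : ∀ j : Fin n, w (j + 1) = v j := fun j => by
    have : (j : ℕ) + 1 ≤ n := j.2
    simp [w, this]
  have hrec : ∀ k < n, w k + w (k + 2) = 2 * Real.cos θ * w (k + 1) := by
    intro k hk
    have h1 := congrFun hv0 ⟨k, hk⟩
    rw [one_add_smul_pathAdj_mulVec] at h1
    simp only [← wv] at h1
    rw [sum_pathAdj_mul w w0 wn] at h1
    simp only [Pi.zero_apply] at h1
    linear_combination (-2 * Real.cos θ) * h1 + (w k + w (k + 2)) * hδ
  have hs := mul_sin_eq_of_recurrence w w0 hrec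
  have w1 : w 1 = 0 := by
    have h1 := hs (n + 1) le_rfl
    rw [wn, zero_mul] at h1
    exact (mul_eq_zero.mp h1.symm).resolve_right hsin'
  funext j
  have h1 := hs (j + 1) (by have := j.2; omega)
  rw [w1, zero_mul, wv] at h1
  exact (mul_eq_zero.mp h1).resolve_right hsin

theorem abs_cos_int_add_half_mul (j : ℤ) (θ : ℝ) :
    |Real.cos ((j + 1 / 2) * θ)| = |Real.sin ((j + 1 / 2) * (Real.pi - θ))| := by
  have h : ((j : ℝ) + 1 / 2) * θ = (Real.pi / 2 - (j + 1 / 2) * (Real.pi - θ)) + j * Real.pi := by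
    ring
  rw [h, Real.cos_add_int_mul_pi, Real.cos_pi_div_two_sub, abs_mul, abs_zpow]
  simp

theorem abs_sin_lt_abs_sin {a b : ℝ} (hab : |a| < b) (hb : b ≤ Real.pi / 2) :
    |Real.sin a| < |Real.sin b| := by
  have hb0 : 0 < b := (abs_nonneg a).trans_lt hab
  have hpi := Real.pi_pos
  rw [Real.abs_sin_eq_sin_abs_of_abs_le_pi (by linarith),
    abs_of_pos (Real.sin_pos_of_pos_of_lt_pi hb0 (by linarith))]
  exact Real.sin_lt_sin_of_lt_of_le_pi_div_two (by linarith [abs_nonneg a]) hb hab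

/-- The symmetric solution of `x k + δ (x (k - 1) + x (k + 1)) = 1` vanishing at `0` and
`2 m + 1`, where `δ = -1 / (2 cos θ)`. -/
noncomputable def pathSolution (m : ℕ) (δ θ : ℝ) (k : ℕ) : ℝ :=
  (1 - Real.cos ((m + 1 / 2 - k) * θ) / Real.cos ((m + 1 / 2) * θ)) / (1 + 2 * δ)

theorem pathSolution_zero {m : ℕ} {δ θ : ℝ} (hc : Real.cos ((m + 1 / 2) * θ) ≠ 0) :
    pathSolution m δ θ 0 = 0 := by
  simp only [pathSolution, Nat.cast_zero, sub_zero, div_self hc, sub_self, zero_div]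

theorem pathSolution_last {m : ℕ} {δ θ : ℝ} (hc : Real.cos ((m + 1 / 2) * θ) ≠ 0) :
    pathSolution m δ θ (2 * m + 1) = 0 := by
  have h : ((m : ℝ) + 1 / 2 - (2 * m + 1 : ℕ)) * θ = -((m + 1 / 2) * θ) := by push_cast; ring
  simp only [pathSolution, h, Real.cos_neg, div_self hc, sub_self, zero_div]

theorem pathSolution_recurrence {m : ℕ} {δ θ : ℝ} (hδ : 2 * δ * Real.cos θ = -1)
    (hδ' : 1 + 2 * δ ≠ 0) (k : ℕ) :
    pathSolution m δ θ (k + 1) + δ * (pathSolution m δ θ k + pathSolution m δ θ (k + 2)) = 1 := by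
  have a1 : ((m : ℝ) + 1 / 2 - k) * θ = (m + 1 / 2 - (k + 1 : ℕ)) * θ + θ := by push_cast; ring
  have a2 : ((m : ℝ) + 1 / 2 - (k + 2 : ℕ)) * θ = (m + 1 / 2 - (k + 1 : ℕ)) * θ - θ := by
    push_cast; ring
  simp only [pathSolution, a1, a2, Real.cos_add, Real.cos_sub]
  rw [← add_div, ← mul_div_assoc, ← add_div, div_eq_one_iff_eq hδ']
  linear_combination
    (-Real.cos ((m + 1 / 2 - (k + 1 : ℕ)) * θ) / Real.cos ((m + 1 / 2) * θ)) * hδ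

theorem pathSolution_eq_sin_mul_sin {m : ℕ} {δ θ : ℝ} (hc : Real.cos ((m + 1 / 2) * θ) ≠ 0)
    (k : ℕ) :
    pathSolution m δ θ (k + 1) = -2 * Real.sin ((k + 1) * θ / 2) *
      Real.sin ((2 * (m : ℝ) - k) * θ / 2) /
        ((1 + 2 * δ) * Real.cos ((2 * (m : ℝ) + 1) * θ / 2)) := by
  have a0 : (2 * (m : ℝ) + 1) * θ / 2 = (m + 1 / 2) * θ := by ring
  have a1 : ((m : ℝ) + 1 / 2 - (k + 1 : ℕ)) * θ =
      (2 * (m : ℝ) - k) * θ / 2 - (k + 1) * θ / 2 := by push_cast; ring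
  have a2 : ((m : ℝ) + 1 / 2) * θ = (2 * (m : ℝ) - k) * θ / 2 + (k + 1) * θ / 2 := by ring
  rw [a0, pathSolution, one_sub_div hc, div_div, mul_comm (Real.cos _)]
  congr 1
  rw [a1, a2, Real.cos_sub, Real.cos_add]
  ring

theorem pathSolution_pos {m : ℕ} {δ θ : ℝ} (hδ : 0 < 1 + 2 * δ) {k : ℕ}
    (hk : |Real.cos ((m + 1 / 2 - k) * θ)| < |Real.cos ((m + 1 / 2) * θ)|) :
    0 < pathSolution m δ θ k := by
  have h : |Real.cos ((m + 1 / 2 - k) * θ) / Real.cos ((m + 1 / 2) * θ)| < 1 := by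
    rw [abs_div, div_lt_one ((abs_nonneg _).trans_lt hk)]
    exact hk
  exact div_pos (sub_pos.mpr (abs_lt.mp h).2) hδ

theorem abs_cos_lt_abs_cos_of_mem {m k : ℕ} {θ : ℝ}
    (hθ : θ ∈ Set.Ioo ((2 * m) / (2 * m + 1) * Real.pi) Real.pi) (hk1 : 1 ≤ k) (hk2 : k ≤ 2 * m) :
    |Real.cos ((m + 1 / 2 - k) * θ)| < |Real.cos ((m + 1 / 2) * θ)| := by
  have e1 := abs_cos_int_add_half_mul ((m : ℤ) - k) θ
  have e2 := abs_cos_int_add_half_mul (m : ℤ) θ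
  push_cast at e1 e2
  rw [sub_add_eq_add_sub] at e1
  rw [e1, e2]
  have hε : 0 < Real.pi - θ := sub_pos.mpr hθ.2
  have hk1' : (1 : ℝ) ≤ k := by exact_mod_cast hk1
  have hk2' : (k : ℝ) ≤ 2 * m := by exact_mod_cast hk2
  apply abs_sin_lt_abs_sin
  · rw [abs_mul, abs_of_pos hε]
    refine mul_lt_mul_of_pos_right ?_ hε
    rw [abs_lt]
    constructor <;> linarith
  · have h := hθ.1
    rw [div_mul_eq_mul_div, div_lt_iff₀ (by positivity)] at h
    linarith

/-- On the admissible range of `θ`, the matrix is invertible and its equilibrium vector is the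
positive explicit solution. -/
theorem evenPath_solution {m : ℕ} (hm : 1 ≤ m) {δ θ : ℝ}
    (hθ : θ ∈ Set.Ioo ((2 * m) / (2 * m + 1) * Real.pi) Real.pi)
    (hδ0 : 0 < δ) (hδ : 2 * δ * Real.cos θ = -1) :
    IsUnit (1 + δ • pathAdj (2 * m)).det ∧
    Real.cos ((m + 1 / 2) * θ) ≠ 0 ∧
    ∀ i : Fin (2 * m), ((1 + δ • pathAdj (2 * m))⁻¹.mulVec (fun _ => 1)) i =
      pathSolution m δ θ (i + 1) := by
  have hδ' : 1 + 2 * δ ≠ 0 := by positivity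
  have hθ0 : 0 < θ := lt_of_le_of_lt (by positivity) hθ.1
  have hc : Real.cos ((m + 1 / 2) * θ) ≠ 0 := abs_pos.mp
    ((abs_nonneg _).trans_lt (abs_cos_lt_abs_cos_of_mem hθ le_rfl (by omega)))
  have hsin' : Real.sin ((2 * m + 1 : ℕ) * θ) ≠ 0 := by
    have h := hθ.1
    rw [div_mul_eq_mul_div, div_lt_iff₀ (by positivity)] at h
    have h2 : (2 * (m : ℝ) + 1) * θ < (2 * m + 1) * Real.pi :=
      mul_lt_mul_of_pos_left hθ.2 (by positivity)
    rw [← Real.sin_sub_nat_mul_two_pi _ m]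
    apply ne_of_gt
    apply Real.sin_pos_of_pos_of_lt_pi <;> push_cast <;> linarith
  have hu := isUnit_det_one_add_smul_pathAdj hδ
    (Real.sin_pos_of_pos_of_lt_pi hθ0 hθ.2).ne' hsin'
  refine ⟨hu, hc, ?_⟩
  have hsol : (1 + δ • pathAdj (2 * m)).mulVec (fun i => pathSolution m δ θ (i + 1)) =
      fun _ => 1 := by
    funext i
    rw [one_add_smul_pathAdj_mulVec,
      sum_pathAdj_mul _ (pathSolution_zero hc) (pathSolution_last hc)]
    exact pathSolution_recurrence hδ hδ' i
  intro i
  rw [← hsol, Matrix.mulVec_mulVec, Matrix.nonsing_inv_mul _ hu, Matrix.one_mulVec]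

theorem exists_angle {m : ℕ} (hm : 1 ≤ m) {δ : ℝ} (hδ1 : 1 / 2 < δ)
    (hδ2 : δ < -1 / (2 * Real.cos ((2 * m) * Real.pi / (2 * m + 1)))) :
    ∃ θ ∈ Set.Ioo ((2 * m) / (2 * m + 1) * Real.pi) Real.pi, 2 * δ * Real.cos θ = -1 := by
  have hpi := Real.pi_pos
  have hm' : (1 : ℝ) ≤ m := by exact_mod_cast hm
  set φ : ℝ := (2 * m) * Real.pi / (2 * m + 1) with hφ
  have hφ' : (2 * m : ℝ) / (2 * m + 1) * Real.pi = φ := div_mul_eq_mul_div _ _ _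
  have hφ1 : Real.pi / 2 < φ := by
    rw [hφ, lt_div_iff₀ (by positivity)]
    nlinarith
  have hφ2 : φ < Real.pi := by
    rw [hφ, div_lt_iff₀ (by positivity)]
    linarith
  have hcφ : Real.cos φ < 0 := Real.cos_neg_of_pi_div_two_lt_of_lt hφ1 (by linarith)
  have hδ0 : 0 < δ := by linarith
  have hlow : -1 < -1 / (2 * δ) := by
    rw [lt_div_iff₀ (by positivity)]
    linarith
  have hup : -1 / (2 * δ) < Real.cos φ := by
    rw [lt_div_iff_of_neg (by linarith)] at hδ2
    rw [div_lt_iff₀ (by positivity)]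
    linarith
  refine ⟨Real.arccos (-1 / (2 * δ)), ⟨?_, ?_⟩, ?_⟩
  · rw [hφ', ← Real.arccos_cos (by linarith) hφ2.le]
    exact Real.strictAntiOn_arccos ⟨hlow.le, by linarith⟩
      ⟨Real.neg_one_le_cos _, Real.cos_le_one _⟩ hup
  · rw [← Real.arccos_neg_one]
    exact Real.strictAntiOn_arccos ⟨le_rfl, by norm_num⟩ ⟨hlow.le, by linarith⟩ hlow
  · rw [Real.cos_arccos hlow.le (by linarith)]
    field_simp

/-- on the even path with `2m` vertices, for
`1/2 < δ < −1/(2cos(2mπ/(2m+1))) = 1/|λ_min(G(2m))|`, the matrix `I + δG(2m)`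
is invertible, the vector `x = (I + δG(2m))⁻¹ 𝟙` is entrywise positive — with
the explicit trigonometric formula when `δ = −1/(2cosθ)`,
`θ ∈ ((2m/(2m+1))π, π]` — and `x` is the (unique) all-active equilibrium. -/
theorem evenPath_allActive_equilibrium
    (m : ℕ) (hm : 1 ≤ m) (δ : ℝ)
    (hδ1 : 1/2 < δ)
    (hδ2 : δ < -1 / (2 * Real.cos ((2*m) * Real.pi / (2*m+1)))) :
    IsUnit (1 + δ • pathAdj (2*m)).det ∧
    (∀ i, 0 < ((1 + δ • pathAdj (2*m))⁻¹.mulVec (fun _ => 1)) i) ∧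
    (∀ i, ((1 + δ • pathAdj (2*m))⁻¹.mulVec (fun _ => 1)) i
        = max 0 (1 - δ * ∑ j, pathAdj (2*m) i j *
            ((1 + δ • pathAdj (2*m))⁻¹.mulVec (fun _ => 1)) j)) ∧
    (∀ θ : ℝ, θ ∈ Set.Ioc ((2*m) / (2*m+1) * Real.pi) Real.pi →
      δ = -1 / (2 * Real.cos θ) →
      ∀ i : Fin (2*m),
        ((1 + δ • pathAdj (2*m))⁻¹.mulVec (fun _ => 1)) i
          = -2 * Real.sin (((i : ℕ) + 1) * θ / 2)
              * Real.sin ((2*(m : ℝ) - (i : ℕ)) * θ / 2)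
            / ((1 + 2*δ) * Real.cos ((2*(m : ℝ) + 1) * θ / 2))) := by
  obtain ⟨θ₀, hθ₀, hcos₀⟩ := exists_angle hm hδ1 hδ2
  have hδ0 : 0 < δ := by linarith
  obtain ⟨hu, -, hx⟩ := evenPath_solution hm hθ₀ hδ0 hcos₀
  have hpos : ∀ i, 0 < ((1 + δ • pathAdj (2*m))⁻¹.mulVec (fun _ => 1)) i := fun i => by
    rw [hx]
    exact pathSolution_pos (by linarith) (abs_cos_lt_abs_cos_of_mem hθ₀ (by omega) i.2)
  refine ⟨hu, hpos, fun i => ?_, fun θ hθ hδ i => ?_⟩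
  · have h := one_add_smul_pathAdj_mulVec δ ((1 + δ • pathAdj (2*m))⁻¹.mulVec (fun _ => 1)) i
    rw [Matrix.mulVec_mulVec, Matrix.mul_nonsing_inv _ hu, Matrix.one_mulVec] at h
    rw [← eq_sub_of_add_eq h.symm, max_eq_right (hpos i).le]
  · have hcos : Real.cos θ ≠ 0 := fun h => by simp [hδ, h] at hδ0
    have hθπ : θ ≠ Real.pi := fun h => by
      rw [hδ, h, Real.cos_pi] at hδ1
      norm_num at hδ1
    have hδ' : 2 * δ * Real.cos θ = -1 := by
      rw [hδ]
      field_simp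
    obtain ⟨-, hc, hx'⟩ := evenPath_solution hm ⟨hθ.1, lt_of_le_of_ne hθ.2 hθπ⟩ hδ0 hδ'
    rw [hx', pathSolution_eq_sin_mul_sin hc]
end

section
/- Fix m ≥ 1 and set δ_c = −1/(2cos(2mπ/(2m+1))) = 1/|λ_min(G(2m))|. For every δ in the open interval (−1/(2cos((2m+2)π/(2m+3))), δ_c), the matrix I + δG(2m) is invertible and, with b(δ,2m) the first entry of (I + δG(2m))⁻¹𝟙, one has 2δ·b(δ,2m) < 1; moreover lim_{δ ↑ δ_c} 2δ·b(δ,2m) = 1. Hence two blocks of 2m active agents cannot share an inactive separating agent in this range of δ, but the inactivity condition is arbitrarily close to being met as δ approaches δ_c. -/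
open Matrix Finset Real Filter

theorem pathAdj_mulVec_apply {n : ℕ} {f : ℕ → ℝ} (h0 : f 0 = 0) (hn : f (n + 1) = 0)
    (i : Fin n) :
    (pathAdj n *ᵥ fun j => f (j + 1)) i = f i + f (i + 2) := by
  have hrow : (pathAdj n *ᵥ fun j => f (j + 1)) i =
      ∑ j ∈ Finset.range n,
        ((if j + 1 = (i : ℕ) then f (j + 1) else 0) +
          if j = (i : ℕ) + 1 then f (j + 1) else 0) := by
    rw [Finset.sum_range]
    simp only [mulVec, dotProduct, pathAdj, Matrix.of_apply]
    refine Finset.sum_congr rfl fun j _ => ?_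
    split_ifs <;> first | omega | simp
  rw [hrow, Finset.sum_add_distrib]
  have hi := i.isLt
  congr 1
  · rcases Nat.eq_zero_or_pos (i : ℕ) with h | h
    · simp [h, h0]
    · rw [Finset.sum_eq_single ((i : ℕ) - 1)]
      · rw [Nat.sub_add_cancel h, if_pos rfl]
      · intro j _ hj
        exact if_neg (by omega)
      · intro hj
        exact absurd (Finset.mem_range.2 (by omega)) hj
  · rw [Finset.sum_ite_eq']
    split_ifs with h
    · rfl
    · rw [Finset.mem_range] at h
      rw [show (i : ℕ) + 2 = n + 1 by omega, hn]

theorem one_add_smul_pathAdj_mulVec_apply {n : ℕ} (δ : ℝ) {f : ℕ → ℝ} (h0 : f 0 = 0)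
    (hn : f (n + 1) = 0) (i : Fin n) :
    ((1 + δ • pathAdj n) *ᵥ fun j : Fin n => f (j + 1)) i = f (i + 1) + δ * (f i + f (i + 2)) := by
  rw [add_mulVec, one_mulVec, smul_mulVec, Pi.add_apply, Pi.smul_apply,
    pathAdj_mulVec_apply h0 hn, smul_eq_mul]

/-- A three-term recurrence with zero initial value is solved by alternating sines. -/
theorem mul_sin_eq_of_recurrence_s12 {n : ℕ} {φ : ℝ} {f : ℕ → ℝ} (h0 : f 0 = 0)
    (hf : ∀ i < n, f (i + 2) = -(2 * Real.cos φ * f (i + 1)) - f i) :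
    ∀ i ≤ n, f i * Real.sin φ = (-1) ^ (i + 1) * Real.sin (i * φ) * f 1 ∧
      f (i + 1) * Real.sin φ = (-1) ^ i * Real.sin ((i + 1) * φ) * f 1 := by
  intro i
  induction i with
  | zero => intro _; simp [h0, mul_comm]
  | succ k ih =>
    intro hk
    obtain ⟨h1, h2⟩ := ih (by omega)
    refine ⟨by rw [h2, pow_succ, pow_succ]; push_cast; ring, ?_⟩
    rw [hf k (by omega), sub_mul, h1, neg_mul, mul_assoc, h2]
    have e1 : Real.sin (((k + 1 : ℕ) + 1) * φ) =
        2 * Real.cos φ * Real.sin ((k + 1) * φ) - Real.sin (k * φ) := by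
      have a1 : (((k + 1 : ℕ) + 1 : ℝ)) * φ = (k + 1) * φ + φ := by push_cast; ring
      have a2 : (k : ℝ) * φ = (k + 1) * φ - φ := by ring
      rw [a1, a2, Real.sin_add, Real.sin_sub]
      ring
    rw [e1, pow_succ]
    ring

theorem isUnit_det_one_add_smul_pathAdj_s12 {n : ℕ} {φ : ℝ} (hφ : Real.cos φ ≠ 0)
    (hs : Real.sin φ ≠ 0) (hn : Real.sin ((n + 1) * φ) ≠ 0) :
    IsUnit (1 + (1 / (2 * Real.cos φ)) • pathAdj n).det := by
  rw [← Matrix.isUnit_iff_isUnit_det, ← Matrix.mulVec_injective_iff_isUnit,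
    ← Matrix.coe_mulVecLin, injective_iff_map_eq_zero]
  intro v hv
  let f : ℕ → ℝ := fun i => if h : 1 ≤ i ∧ i ≤ n then v ⟨i - 1, by omega⟩ else 0
  have h0 : f 0 = 0 := by simp [f]
  have hn1 : f (n + 1) = 0 := by simp [f]
  have hfv : (fun j : Fin n => f (j + 1)) = v := by
    funext j
    have := j.isLt
    simp [f]
  have hrec : ∀ i < n, f (i + 2) = -(2 * Real.cos φ * f (i + 1)) - f i := by
    intro i hi
    have h := one_add_smul_pathAdj_mulVec_apply (1 / (2 * Real.cos φ)) h0 hn1 ⟨i, hi⟩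
    rw [hfv] at h
    rw [Matrix.mulVecLin_apply] at hv
    rw [hv] at h
    simp only [Pi.zero_apply] at h
    field_simp at h
    linarith
  have key := mul_sin_eq_of_recurrence_s12 h0 hrec
  have h1 : f 1 = 0 := by
    have h := (key n le_rfl).2
    rw [hn1, zero_mul] at h
    simpa [hn] using h.symm
  rw [← hfv]
  funext j
  have h := (key j j.isLt.le).2
  rw [h1, mul_zero] at h
  simpa [hs] using h

/-- With `2 cos φ = δ⁻¹`, the equilibrium on a path of even length is an affine combination of the
constant vector and alternating sines. -/
theorem one_add_smul_pathAdj_inv_mulVec_one {m : ℕ} {φ : ℝ} (hφ : 0 < Real.cos φ)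
    (hs : Real.sin ((2 * m + 1) / 2 * φ) ≠ 0)
    (hdet : IsUnit (1 + (1 / (2 * Real.cos φ)) • pathAdj (2 * m)).det) (i : Fin (2 * m)) :
    ((1 + (1 / (2 * Real.cos φ)) • pathAdj (2 * m))⁻¹ *ᵥ fun _ => 1) i =
      Real.cos φ / (1 + Real.cos φ) *
        (1 - (-1) ^ ((i : ℕ) + 1) * Real.sin (((2 * m + 1) / 2 - ((i : ℕ) + 1)) * φ) /
          Real.sin ((2 * m + 1) / 2 * φ)) := by
  let f : ℕ → ℝ := fun i => Real.cos φ / (1 + Real.cos φ) *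
    (1 - (-1) ^ i * Real.sin (((2 * m + 1) / 2 - i) * φ) / Real.sin ((2 * m + 1) / 2 * φ))
  have hc : 1 + Real.cos φ ≠ 0 := by positivity
  have h0 : f 0 = 0 := by simp [f, hs]
  have hn : f (2 * m + 1) = 0 := by
    have e : ((2 * m + 1) / 2 - ((2 * m + 1 : ℕ) : ℝ)) * φ = -((2 * m + 1) / 2 * φ) := by
      push_cast; ring
    simp only [f]
    rw [e, Real.sin_neg, pow_succ, pow_mul]
    simp [hs]
  have hsol : (1 + (1 / (2 * Real.cos φ)) • pathAdj (2 * m)) *ᵥ (fun j : Fin (2 * m) => f (j + 1)) =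
      fun _ => 1 := by
    funext j
    rw [one_add_smul_pathAdj_mulVec_apply _ h0 hn]
    have e1 : ((2 * m + 1) / 2 - ((j : ℕ) : ℝ)) * φ =
        ((2 * m + 1) / 2 - (((j : ℕ) + 1 : ℕ) : ℝ)) * φ + φ := by push_cast; ring
    have e2 : ((2 * m + 1) / 2 - (((j : ℕ) + 2 : ℕ) : ℝ)) * φ =
        ((2 * m + 1) / 2 - (((j : ℕ) + 1 : ℕ) : ℝ)) * φ - φ := by push_cast; ring
    simp only [f]
    rw [e1, e2, Real.sin_add, Real.sin_sub, pow_succ, pow_add]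
    field_simp
    ring
  rw [← hsol, mulVec_mulVec, Matrix.nonsing_inv_mul _ hdet, one_mulVec]
  simp [f]

theorem two_delta_endpoint_eq {m : ℕ} (hm : 0 < 2 * m) {φ : ℝ} (hpos : 0 < φ)
    (hlt : φ < Real.pi / (2 * m + 1)) :
    IsUnit (1 + (1 / (2 * Real.cos φ)) • pathAdj (2 * m)).det ∧
    2 * (1 / (2 * Real.cos φ)) *
        (((1 + (1 / (2 * Real.cos φ)) • pathAdj (2 * m))⁻¹ *ᵥ fun _ => 1) ⟨0, hm⟩) =
      1 - Real.cos ((2 * m + 1) / 2 * φ) / Real.sin ((2 * m + 1) / 2 * φ) *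
        (Real.sin φ / (1 + Real.cos φ)) := by
  have hm' : (1 : ℝ) ≤ m := by exact_mod_cast (by omega : 1 ≤ m)
  have hπ := Real.pi_pos
  have hlt' : (2 * m + 1) * φ < Real.pi := by
    rwa [lt_div_iff₀ (by positivity), mul_comm] at hlt
  have h3 : 3 * φ < Real.pi := by nlinarith
  have hcos : 0 < Real.cos φ := Real.cos_pos_of_mem_Ioo ⟨by linarith, by linarith⟩
  have hsin : 0 < Real.sin φ := Real.sin_pos_of_pos_of_lt_pi hpos (by linarith)
  have hsinN : 0 < Real.sin ((2 * m + 1) * φ) :=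
    Real.sin_pos_of_pos_of_lt_pi (by positivity) hlt'
  have hsinH : 0 < Real.sin ((2 * m + 1) / 2 * φ) :=
    Real.sin_pos_of_pos_of_lt_pi (by positivity) (by linarith)
  have hdet : IsUnit (1 + (1 / (2 * Real.cos φ)) • pathAdj (2 * m)).det :=
    isUnit_det_one_add_smul_pathAdj_s12 hcos.ne' hsin.ne' (by push_cast; exact hsinN.ne')
  refine ⟨hdet, ?_⟩
  rw [one_add_smul_pathAdj_inv_mulVec_one hcos hsinH.ne' hdet]
  have e : ((2 * m + 1) / 2 - (((0 : ℕ) : ℝ) + 1)) * φ = (2 * m + 1) / 2 * φ - φ := by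
    push_cast; ring
  rw [e, Real.sin_sub]
  generalize (2 * (m : ℝ) + 1) / 2 * φ = ψ at hsinH ⊢
  have hs := hsinH.ne'
  have hc : 1 + Real.cos φ ≠ 0 := by positivity
  field_simp
  ring

theorem neg_one_div_two_cos_eq {x : ℝ} (hx : x ≠ 0) :
    -1 / (2 * Real.cos ((x - 1) * Real.pi / x)) = 1 / (2 * Real.cos (Real.pi / x)) := by
  rw [show (x - 1) * Real.pi / x = Real.pi - Real.pi / x by field_simp, Real.cos_pi_sub,
    mul_neg, div_neg, neg_div, neg_neg]

/-- set `δ_c = −1/(2cos(2mπ/(2m+1))) = 1/|λ_min(G(2m))|`. For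
every `δ` in `(−1/(2cos((2m+2)π/(2m+3))), δ_c)` the matrix `I + δG(2m)` is
invertible and the endpoint entry `b(δ,2m)` of `(I + δG(2m))⁻¹𝟙` satisfies
`2δ·b(δ,2m) < 1`; moreover `2δ·b(δ,2m) → 1` as `δ ↑ δ_c`. -/
theorem two_delta_b_lt_one_and_tendsto
    (m : ℕ) (hm : 1 ≤ m) :
    (∀ δ ∈ Set.Ioo (-1 / (2 * Real.cos ((2*m+2) * Real.pi / (2*m+3))))
                   (-1 / (2 * Real.cos ((2*m) * Real.pi / (2*m+1)))),
      IsUnit (1 + δ • pathAdj (2*m)).det ∧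
      2 * δ * (((1 + δ • pathAdj (2*m))⁻¹.mulVec (fun _ => 1)) ⟨0, by omega⟩) < 1) ∧
    Tendsto
      (fun δ : ℝ => 2 * δ * (((1 + δ • pathAdj (2*m))⁻¹.mulVec (fun _ => 1)) ⟨0, by omega⟩))
      (nhdsWithin (-1 / (2 * Real.cos ((2*m) * Real.pi / (2*m+1))))
        (Set.Ioo (-1 / (2 * Real.cos ((2*m+2) * Real.pi / (2*m+3))))
                 (-1 / (2 * Real.cos ((2*m) * Real.pi / (2*m+1))))))
      (nhds 1) := by
  have hm' : (1 : ℝ) ≤ m := by exact_mod_cast hm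
  have hπ := Real.pi_pos
  have hlo := neg_one_div_two_cos_eq (x := 2 * m + 3) (by positivity)
  have hhi := neg_one_div_two_cos_eq (x := 2 * m + 1) (by positivity)
  rw [show (2 * m + 3 - 1 : ℝ) = 2 * m + 2 by ring] at hlo
  rw [show (2 * m + 1 - 1 : ℝ) = 2 * m by ring] at hhi
  rw [hlo, hhi]
  have hN : Real.pi / (2 * m + 1) ≤ Real.pi / 3 :=
    div_le_div_of_nonneg_left hπ.le (by norm_num) (by linarith)
  have hN0 : 0 < Real.pi / (2 * m + 1) := by positivity
  have hM : Real.pi / (2 * m + 3) < Real.pi / (2 * m + 1) :=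
    div_lt_div_of_pos_left hπ (by positivity) (by linarith)
  have hM0 : 0 < Real.pi / (2 * m + 3) := by positivity
  have hcN : 0 < Real.cos (Real.pi / (2 * m + 1)) :=
    Real.cos_pos_of_mem_Ioo ⟨by linarith, by linarith⟩
  have hcM : 0 < Real.cos (Real.pi / (2 * m + 3)) :=
    Real.cos_pos_of_mem_Ioo ⟨by linarith, by linarith⟩
  have hparam : ∀ δ ∈ Set.Ioo (1 / (2 * Real.cos (Real.pi / (2 * m + 3))))
      (1 / (2 * Real.cos (Real.pi / (2 * m + 1)))),
      0 < Real.arccos (1 / (2 * δ)) ∧ Real.arccos (1 / (2 * δ)) < Real.pi / (2 * m + 1) ∧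
        1 / (2 * Real.cos (Real.arccos (1 / (2 * δ)))) = δ := by
    rintro δ ⟨h1, h2⟩
    have hδ : 0 < δ := lt_trans (by positivity) h1
    have hlt : 1 / (2 * δ) < 1 := by
      rw [div_lt_iff₀ (by positivity)] at h1 ⊢
      nlinarith [Real.cos_le_one (Real.pi / (2 * m + 3))]
    have hgt : Real.cos (Real.pi / (2 * m + 1)) < 1 / (2 * δ) := by
      rw [lt_div_iff₀ (by positivity)] at h2 ⊢
      linarith
    refine ⟨Real.arccos_pos.2 hlt, ?_, ?_⟩
    · rw [← Real.arccos_cos hN0.le (by linarith : Real.pi / (2 * m + 1) ≤ Real.pi)]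
      exact Real.arccos_lt_arccos (Real.neg_one_le_cos _) hgt hlt.le
    · rw [Real.cos_arccos (by linarith) hlt.le]
      field_simp
  constructor
  · intro δ hδ
    obtain ⟨h0, h1, h2⟩ := hparam δ hδ
    have h := two_delta_endpoint_eq (by omega) h0 h1
    rw [h2] at h
    refine ⟨h.1, ?_⟩
    rw [h.2]
    set φ := Real.arccos (1 / (2 * δ))
    have hlt : (2 * m + 1) * φ < Real.pi := by
      rwa [lt_div_iff₀ (by positivity), mul_comm] at h1
    have hcosH : 0 < Real.cos ((2 * m + 1) / 2 * φ) :=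
      Real.cos_pos_of_mem_Ioo ⟨by linarith [mul_pos (by positivity : (0 : ℝ) < (2 * m + 1) / 2) h0],
        by linarith⟩
    have hsinH : 0 < Real.sin ((2 * m + 1) / 2 * φ) :=
      Real.sin_pos_of_pos_of_lt_pi (by positivity) (by linarith)
    have hcos : 0 < Real.cos φ := Real.cos_pos_of_mem_Ioo ⟨by linarith, by linarith⟩
    have hsin : 0 < Real.sin φ := Real.sin_pos_of_pos_of_lt_pi h0 (by linarith)
    have : 0 < Real.cos ((2 * m + 1) / 2 * φ) / Real.sin ((2 * m + 1) / 2 * φ) *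
        (Real.sin φ / (1 + Real.cos φ)) := by positivity
    linarith
  · set δc := 1 / (2 * Real.cos (Real.pi / (2 * m + 1))) with hδc
    have hδc0 : 0 < δc := by positivity
    have hφc : Real.arccos (1 / (2 * δc)) = Real.pi / (2 * m + 1) := by
      rw [show 1 / (2 * δc) = Real.cos (Real.pi / (2 * m + 1)) by rw [hδc]; field_simp,
        Real.arccos_cos hN0.le (by linarith)]
    have hhalf : (2 * m + 1) / 2 * (Real.pi / (2 * m + 1)) = Real.pi / 2 := by field_simp
    have hφ : Tendsto (fun δ : ℝ => Real.arccos (1 / (2 * δ))) (nhds δc)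
        (nhds (Real.pi / (2 * m + 1))) := by
      rw [← hφc]
      have hdiv : ContinuousAt (fun δ : ℝ => 1 / (2 * δ)) δc :=
        continuousAt_const.div (by fun_prop) (by positivity)
      exact (Real.continuous_arccos.tendsto _).comp hdiv.tendsto
    have hF : Tendsto (fun φ : ℝ => 1 - Real.cos ((2 * m + 1) / 2 * φ) /
        Real.sin ((2 * m + 1) / 2 * φ) * (Real.sin φ / (1 + Real.cos φ)))
        (nhds (Real.pi / (2 * m + 1))) (nhds 1) := by
      have hcont : ContinuousAt (fun φ : ℝ => 1 - Real.cos ((2 * m + 1) / 2 * φ) /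
          Real.sin ((2 * m + 1) / 2 * φ) * (Real.sin φ / (1 + Real.cos φ)))
          (Real.pi / (2 * m + 1)) := by
        refine continuousAt_const.sub (ContinuousAt.mul (ContinuousAt.div (by fun_prop)
          (by fun_prop) ?_) (ContinuousAt.div (by fun_prop) (by fun_prop) (by positivity)))
        rw [hhalf, Real.sin_pi_div_two]
        exact one_ne_zero
      have h := hcont.tendsto
      simp only [hhalf, Real.cos_pi_div_two, zero_div, zero_mul, sub_zero] at h
      exact h
    refine Tendsto.congr' ?_ ((hF.comp hφ).mono_left nhdsWithin_le_nhds)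
    filter_upwards [self_mem_nhdsWithin] with δ hδ
    obtain ⟨h0, h1, h2⟩ := hparam δ hδ
    have h := (two_delta_endpoint_eq (by omega) h0 h1).2
    rw [h2] at h
    exact h.symm
end

section
/- Let G be a finite connected simple graph that is P₄-free, C₄-free and K_{1,3}-free. Then either G is a complete graph (a clique extension of P₁), or G is a clique extension of P₃: the vertex set of G partitions into three nonempty sets V₁, V₂, V₃, each of which induces a clique, such that every vertex of V₁ is adjacent to every vertex of V₂, every vertex of V₂ is adjacent to every vertex of V₃, and no vertex of V₁ is adjacent to any vertex of V₃. Consequently, every finite P₄-, C₄- and K_{1,3}-free simple graph is a disjoint union of clique extensions of P₁ or P₃. -/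
open SimpleGraph

/-- The path graph `P₄` on 4 vertices (edges 01, 12, 23). -/
def pathFour : SimpleGraph (Fin 4) :=
  SimpleGraph.fromRel (fun i j => (i : ℕ) + 1 = (j : ℕ))

/-- The cycle graph `C₄` on 4 vertices (edges 01, 12, 23, 30). -/
def cycleFour : SimpleGraph (Fin 4) :=
  SimpleGraph.fromRel (fun i j => ((i : ℕ) + 1) % 4 = (j : ℕ))

/-- The star graph `K_{1,3}` with center `0` and leaves `1, 2, 3`. -/
def starOneThree : SimpleGraph (Fin 4) :=
  SimpleGraph.fromRel (fun i j => i = 0 ∧ j ≠ 0)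

namespace SimpleGraph

variable {V : Type*} {G : SimpleGraph V}

/-- A set of vertices closed under adjacency is closed under reachability. -/
theorem Reachable.of_closed {p : V → Prop} (hp : ∀ x y, G.Adj x y → p x → p y)
    {u v : V} (h : G.Reachable u v) (hu : p u) : p v := by
  obtain ⟨w⟩ := h
  induction w with
  | nil => exact hu
  | cons hadj _ ih => exact ih (hp _ _ hadj hu)

theorem false_of_pathFour_free (h : IsEmpty (SimpleGraph.Embedding pathFour G)) {a b c d : V}
    (hab : G.Adj a b) (hbc : G.Adj b c) (hcd : G.Adj c d)
    (hac : ¬ G.Adj a c) (hbd : ¬ G.Adj b d) (had : ¬ G.Adj a d) : False := by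
  have := hab.ne
  have := hbc.ne
  have := hcd.ne
  have : a ≠ c := by rintro rfl; exact had hcd
  have : b ≠ d := by rintro rfl; exact had hab
  have : a ≠ d := by rintro rfl; exact hbd hab.symm
  refine h.false ⟨⟨![a, b, c, d], ?_⟩, ?_⟩
  · intro i j hij
    fin_cases i <;> fin_cases j <;> simp_all
  · intro i j
    change G.Adj (![a, b, c, d] i) (![a, b, c, d] j) ↔ _
    fin_cases i <;> fin_cases j <;> simp_all [pathFour, G.adj_comm]

theorem false_of_cycleFour_free (h : IsEmpty (SimpleGraph.Embedding cycleFour G)) {a b c d : V}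
    (hab : G.Adj a b) (hbc : G.Adj b c) (hcd : G.Adj c d) (hda : G.Adj d a)
    (hne : a ≠ c) (hne' : b ≠ d) (hac : ¬ G.Adj a c) (hbd : ¬ G.Adj b d) : False := by
  have := hab.ne
  have := hbc.ne
  have := hcd.ne
  have := hda.ne
  refine h.false ⟨⟨![a, b, c, d], ?_⟩, ?_⟩
  · intro i j hij
    fin_cases i <;> fin_cases j <;> simp_all
  · intro i j
    change G.Adj (![a, b, c, d] i) (![a, b, c, d] j) ↔ _
    fin_cases i <;> fin_cases j <;> simp_all [cycleFour, G.adj_comm]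

theorem false_of_starOneThree_free (h : IsEmpty (SimpleGraph.Embedding starOneThree G))
    {a b c d : V} (hab : G.Adj a b) (hac : G.Adj a c) (had : G.Adj a d)
    (hne : b ≠ c) (hne' : b ≠ d) (hne'' : c ≠ d)
    (hbc : ¬ G.Adj b c) (hbd : ¬ G.Adj b d) (hcd : ¬ G.Adj c d) : False := by
  have := hab.ne
  have := hac.ne
  have := had.ne
  refine h.false ⟨⟨![a, b, c, d], ?_⟩, ?_⟩
  · intro i j hij
    fin_cases i <;> fin_cases j <;> simp_all
  · intro i j
    change G.Adj (![a, b, c, d] i) (![a, b, c, d] j) ↔ _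
    fin_cases i <;> fin_cases j <;> simp_all [starOneThree, G.adj_comm]

/-- A connected graph that is not complete contains an induced path on three vertices. -/
theorem Connected.exists_induced_path_three (hconn : G.Connected)
    (h : ¬ ∀ u v : V, u ≠ v → G.Adj u v) :
    ∃ a b c, G.Adj a b ∧ G.Adj b c ∧ a ≠ c ∧ ¬ G.Adj a c := by
  by_contra! hno
  refine h fun u v huv => ?_
  have : u = v ∨ G.Adj u v :=
    (hconn u v).of_closed (p := fun v => u = v ∨ G.Adj u v) (fun x y hxy hx => by
      rcases hx with rfl | hx
      · exact .inr hxy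
      · exact or_iff_not_imp_left.2 (hno u x y hx hxy)) (.inl rfl)
  exact this.resolve_left huv

/-- In a connected graph with no induced `P₄`, `C₄` or `K_{1,3}`, the middle vertex of an induced
path on three vertices is adjacent to all other vertices. -/
theorem Connected.adj_middle_of_free (hconn : G.Connected)
    (hP4 : IsEmpty (SimpleGraph.Embedding pathFour G))
    (hC4 : IsEmpty (SimpleGraph.Embedding cycleFour G))
    (hK13 : IsEmpty (SimpleGraph.Embedding starOneThree G))
    {a b c : V} (hab : G.Adj a b) (hbc : G.Adj b c) (hne : a ≠ c) (hac : ¬ G.Adj a c)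
    {x : V} (hx : b ≠ x) : G.Adj b x := by
  have near_a : ∀ x, b ≠ x → G.Adj x a → G.Adj b x := fun x hx hxa => by
    by_contra hbx
    by_cases hxc : G.Adj x c
    · exact false_of_cycleFour_free hC4 hab hbc hxc.symm hxa hne hx hac hbx
    · exact false_of_pathFour_free hP4 hxa hab hbc (fun h => hbx h.symm) hac hxc
  have near_c : ∀ x, b ≠ x → G.Adj x c → G.Adj b x := fun x hx hxc => by
    by_contra hbx
    have hxa : ¬ G.Adj x a := fun h => hbx (near_a x hx h)
    exact false_of_pathFour_free hP4 hxc hbc.symm hab.symm (fun h => hbx h.symm)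
      (fun h => hac h.symm) hxa
  refine ((hconn b x).of_closed (p := fun x => b = x ∨ G.Adj b x) (fun y x hyx hy => ?_)
    (.inl rfl)).resolve_left hx
  rcases hy with rfl | hby
  · exact .inr hyx
  by_contra! hn
  obtain ⟨hbx, hnbx⟩ := hn
  have hxa : ¬ G.Adj x a := fun h => hnbx (near_a x hbx h)
  have hxc : ¬ G.Adj x c := fun h => hnbx (near_c x hbx h)
  have hya : y ≠ a := by rintro rfl; exact hxa hyx.symm
  have hyc : y ≠ c := by rintro rfl; exact hxc hyx.symm
  have hnxb : ¬ G.Adj x b := fun h => hnbx h.symm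
  by_cases hAdjya : G.Adj y a <;> by_cases hAdjyc : G.Adj y c
  · have hxa' : x ≠ a := by rintro rfl; exact hnbx hab.symm
    have hxc' : x ≠ c := by rintro rfl; exact hnbx hbc
    exact false_of_starOneThree_free hK13 hyx hAdjya hAdjyc hxa' hxc' hne hxa hxc hac
  · exact false_of_pathFour_free hP4 hyx.symm hby.symm hbc hnxb hAdjyc hxc
  · exact false_of_pathFour_free hP4 hyx.symm hby.symm hab.symm hnxb hAdjya hxa
  · exact false_of_starOneThree_free hK13 hby hab.symm hbc hya hyc hne hAdjya hAdjyc hac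

/-- In a claw-free graph, if `b` is adjacent to all other vertices, then the vertices distinct from
and not adjacent to a fixed vertex `c ≠ b` form a clique. -/
theorem adj_of_not_adj_of_starOneThree_free
    (hK13 : IsEmpty (SimpleGraph.Embedding starOneThree G))
    {b c : V} (hb : ∀ x, b ≠ x → G.Adj b x) (hbc : b ≠ c) {u v : V}
    (hu : u ≠ c ∧ ¬ G.Adj u c) (hv : v ≠ c ∧ ¬ G.Adj v c) (huv : u ≠ v) : G.Adj u v := by
  by_contra hn
  have hbu : b ≠ u := by rintro rfl; exact hu.2 (hb c hbc)
  have hbv : b ≠ v := by rintro rfl; exact hv.2 (hb c hbc)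
  exact false_of_starOneThree_free hK13 (hb u hbu) (hb v hbv) (hb c hbc) huv hu.1 hv.1 hn hu.2 hv.2

end SimpleGraph

/-- a finite connected `P₄`-, `C₄`- and `K_{1,3}`-free simple
graph is either complete (a clique extension of `P₁`) or a clique extension of
`P₃`: its vertices split into three nonempty cliques `V₁, V₂, V₃` with `V₁`
completely joined to `V₂`, `V₂` completely joined to `V₃`, and no edges
between `V₁` and `V₃`. -/
theorem structure_of_free_connected_graph
    {V : Type*} [Fintype V] (G : SimpleGraph V) (hconn : G.Connected)
    (hP4 : IsEmpty (SimpleGraph.Embedding pathFour G))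
    (hC4 : IsEmpty (SimpleGraph.Embedding cycleFour G))
    (hK13 : IsEmpty (SimpleGraph.Embedding starOneThree G)) :
    (∀ u v : V, u ≠ v → G.Adj u v) ∨
    ∃ V₁ V₂ V₃ : Set V,
      V₁.Nonempty ∧ V₂.Nonempty ∧ V₃.Nonempty ∧
      (∀ v : V, v ∈ V₁ ∨ v ∈ V₂ ∨ v ∈ V₃) ∧
      Disjoint V₁ V₂ ∧ Disjoint V₂ V₃ ∧ Disjoint V₁ V₃ ∧
      (∀ u ∈ V₁, ∀ v ∈ V₁, u ≠ v → G.Adj u v) ∧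
      (∀ u ∈ V₂, ∀ v ∈ V₂, u ≠ v → G.Adj u v) ∧
      (∀ u ∈ V₃, ∀ v ∈ V₃, u ≠ v → G.Adj u v) ∧
      (∀ u ∈ V₁, ∀ v ∈ V₂, G.Adj u v) ∧
      (∀ u ∈ V₂, ∀ v ∈ V₃, G.Adj u v) ∧
      (∀ u ∈ V₁, ∀ v ∈ V₃, ¬ G.Adj u v) := by
  by_cases hcomplete : ∀ u v : V, u ≠ v → G.Adj u v
  · exact .inl hcomplete
  obtain ⟨a, b, c, hab, hbc, hne, hac⟩ := hconn.exists_induced_path_three hcomplete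
  have hca : ¬ G.Adj c a := fun h => hac h.symm
  have hb : ∀ x, b ≠ x → G.Adj b x := fun x hx =>
    hconn.adj_middle_of_free hP4 hC4 hK13 hab hbc hne hac hx
  have clique_c {u v : V} := adj_of_not_adj_of_starOneThree_free hK13 hb hbc.ne (u := u) (v := v)
  have clique_a {u v : V} := adj_of_not_adj_of_starOneThree_free hK13 hb hab.ne' (u := u) (v := v)
  have adj_a {u : V} (hu : u ≠ c ∧ ¬ G.Adj u c) (hua : u ≠ a) : G.Adj u a :=
    clique_c hu ⟨hne, hac⟩ hua
  have adj_c {u : V} (hu : u ≠ a ∧ ¬ G.Adj u a) (huc : u ≠ c) : G.Adj u c :=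
    clique_a hu ⟨hne.symm, hca⟩ huc
  refine .inr ⟨{x | x ≠ c ∧ ¬ G.Adj x c}, {x | G.Adj x a ∧ G.Adj x c}, {x | x ≠ a ∧ ¬ G.Adj x a},
    ⟨a, hne, hac⟩, ⟨b, hab.symm, hbc⟩, ⟨c, hne.symm, hca⟩, fun v => ?_,
    Set.disjoint_left.2 fun v hv hv' => hv.2 hv'.2, Set.disjoint_left.2 fun v hv hv' => hv'.2 hv.1,
    Set.disjoint_left.2 fun v hv hv' => hv.2 (adj_c hv' hv.1),
    fun u hu v hv => clique_c hu hv, fun u hu v hv huv => ?_, fun u hu v hv => clique_a hu hv,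
    fun u hu v hv => ?_, fun u hu v hv => ?_, fun u hu v hv huv => ?_⟩
  · by_cases hvc : v = c
    · exact .inr (.inr ⟨hvc ▸ hne.symm, hvc ▸ hca⟩)
    by_cases hva : v = a
    · exact .inl ⟨hvc, hva ▸ hac⟩
    simp only [Set.mem_ofPred_eq]
    tauto
  · by_contra hn
    exact false_of_cycleFour_free hC4 hu.1.symm hu.2 hv.2.symm hv.1 hne huv hac hn
  · by_cases hua : u = a
    · exact hua ▸ hv.1.symm
    by_contra hn
    exact false_of_pathFour_free hP4 (adj_a hu hua) hv.1.symm hv.2 hn hac hu.2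
  · by_cases hvc : v = c
    · exact hvc ▸ hu.2
    by_contra hn
    exact false_of_pathFour_free hP4 hu.1.symm hu.2 (adj_c hv hvc).symm hac hn fun h => hv.2 h.symm
  · have hua : u ≠ a := by rintro rfl; exact hv.2 huv.symm
    have hvc : v ≠ c := by rintro rfl; exact hu.2 huv
    exact false_of_pathFour_free hP4 (adj_a hu hua).symm huv (adj_c hv hvc)
      (fun h => hv.2 h.symm) hu.2 hac
end

section
/- Let δ ∈ (1/2, 1) and let n₁, n₂, n₃ ≥ 1 be integers. Then there exist no positive reals x₁, x₂, x₃ > 0 satisfying the system: x₁ + δ((n₁−1)x₁ + n₂x₂) = 1, x₂ + δ((n₂−1)x₂ + n₁x₁ + n₃x₃) = 1, and x₃ + δ((n₃−1)x₃ + n₂x₂) = 1. Consequently, for δ ∈ (1/2, 1), a clique extension of P₃ with clique sizes n₁, n₂, n₃ admits no equilibrium of the network game in which all agents are active. -/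
/-- for `δ ∈ (1/2, 1)` and clique sizes `n₁, n₂, n₃ ≥ 1`, the
linear system describing an all-active equilibrium on a clique extension of
`P₃` has no solution with `x₁, x₂, x₃ > 0`; hence such a graph admits no
all-active equilibrium. -/
theorem no_allActive_equilibrium_cliqueExtension_P3
    (δ : ℝ) (hδ : δ ∈ Set.Ioo (1/2 : ℝ) 1)
    (n₁ n₂ n₃ : ℕ) (h₁ : 1 ≤ n₁) (h₂ : 1 ≤ n₂) (h₃ : 1 ≤ n₃) :
    ¬ ∃ x₁ x₂ x₃ : ℝ, 0 < x₁ ∧ 0 < x₂ ∧ 0 < x₃ ∧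
      x₁ + δ * (((n₁ : ℝ) - 1) * x₁ + n₂ * x₂) = 1 ∧
      x₂ + δ * (((n₂ : ℝ) - 1) * x₂ + n₁ * x₁ + n₃ * x₃) = 1 ∧
      x₃ + δ * (((n₃ : ℝ) - 1) * x₃ + n₂ * x₂) = 1 := by
  rintro ⟨x₁, x₂, x₃, p₁, p₂, p₃, e₁, e₂, e₃⟩
  obtain ⟨hδ₁, hδ₂⟩ := hδ
  have q₁ : (1 : ℝ) ≤ n₁ := by exact_mod_cast h₁
  have q₃ : (1 : ℝ) ≤ n₃ := by exact_mod_cast h₃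
  have hδ₀ : 0 < δ := by linarith
  have s₁ : δ * x₁ ≤ δ * (n₁ * x₁) :=
    mul_le_mul_of_nonneg_left (le_mul_of_one_le_left p₁.le q₁) hδ₀.le
  have s₃ : δ * x₃ ≤ δ * (n₃ * x₃) :=
    mul_le_mul_of_nonneg_left (le_mul_of_one_le_left p₃.le q₃) hδ₀.le
  have t₁ : (1 - δ) * x₁ < δ * x₁ := mul_lt_mul_of_pos_right (by linarith) p₁
  have t₃ : (1 - δ) * x₃ < δ * x₃ := mul_lt_mul_of_pos_right (by linarith) p₃
  have t₂ : 0 < (1 - δ) * x₂ := mul_pos (by linarith) p₂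
  linarith
end
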